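/- With H(b_i ⊗ b_j) = max(i, 2−j) − 1, the generating function of multi-grounded partitions in ²𝒫^≫_{c_2 c_0} having an even total number of parts satisfies: ∑_{π ∈ ²𝒫^≫_{c_2 c_0}, even number of parts} C(π) q^{|π|} = (c_0 c_2 / (c_0 c_2 q⁴; q⁴)_∞) · (1/2) · [ (−c_0 q; q²)_∞ (−c_2 q; q²)_∞ / (c_1 q; q²)_∞ + (c_0 q; q²)_∞ (c_2 q; q²)_∞ / (−c_1 q; q²)_∞ ], valid for complex q, c_0, c_1, c_2 with |q| < 1 and |c_0|, |c_1|, |c_2| ≤ 1. -/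

import Mathlib

open scoped BigOperators

/-- The infinite q-Pochhammer symbol `(a; q)_∞ = ∏_{k≥0} (1 - a qᵏ)`. -/
noncomputable def qPoch (a q : ℂ) : ℂ := ∏' k : ℕ, (1 - a * q ^ k)

/-- The energy function `H(b_i ⊗ b_j) = max(i, 2−j) − 1` for the level-2 perfect crystal
of `A_1^{(1)}`, with `i, j ∈ {0,1,2}`, valued in `ℤ`. -/
def H2 (i j : ℕ) : ℤ := max (i : ℤ) (2 - (j : ℤ)) - 1

/-- The step condition: writing `x = π_k` and `y = π_{k+1}` as pairs (part, colour), it requires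
`p_k − p_{k+1} − 2H(b_{a_{k+1}} ⊗ b_{a_k}) ∈ 2ℤ_{≥0}`. -/
def Step2 (x y : ℤ × ℕ) : Prop := ∃ t : ℕ, x.1 - y.1 - 2 * H2 y.2 x.2 = 2 * (t : ℤ)

/-- Multi-grounded partitions in `²𝒫^≫_{c_2 c_0}`: lists of (part, colour) pairs with colours
in `{0,1,2}`, all consecutive steps satisfying the condition `Step2`, whose last two parts are
`−1` coloured `c_2` and `1` coloured `c_0`, and such that the two parts preceding this tail are
not `(−1)_{c_2}, 1_{c_0}`. -/
def MG20 (L : List (ℤ × ℕ)) : Prop :=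
  (∀ p ∈ L, p.2 ≤ 2) ∧ List.Chain' Step2 L ∧
    ∃ M, L = M ++ [((-1 : ℤ), 2), ((1 : ℤ), 0)] ∧
      ¬ ∃ M', M = M' ++ [((-1 : ℤ), 2), ((1 : ℤ), 0)]

/-- The generating function `∑_π C(π) q^{|π|}` over all lists satisfying a predicate `P`, where
`C(π) = c_0^A c_1^B c_2^D` records the numbers of parts of each colour, and `|π|` is the sum
of the parts. -/
noncomputable def genFun (P : List (ℤ × ℕ) → Prop) (q c0 c1 c2 : ℂ) : ℂ :=
  ∑' L : {L : List (ℤ × ℕ) // P L},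
    c0 ^ (L.1.countP fun p => p.2 == 0) * c1 ^ (L.1.countP fun p => p.2 == 1) *
      c2 ^ (L.1.countP fun p => p.2 == 2) * q ^ ((L.1.map Prod.fst).sum)

open Filter Topology

/-- The generating function of the set of words `A`, with letters weighted by `w`, converges
absolutely to `x`. -/
def HasGF {α : Type*} (w : α → ℂ) (A : Set (List α)) (x : ℂ) : Prop :=
  Summable (fun l : A => ‖(l.1.map w).prod‖) ∧ ∑' l : A, (l.1.map w).prod = x

lemma hasGF_of_range {α ι : Type*} {w : α → ℂ} {A : Set (List α)} {x : ℂ} {f : ι → List α}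
    (hf : Function.Injective f) (hA : Set.range f = A)
    (hs : Summable fun i => ‖((f i).map w).prod‖) (hx : ∑' i, ((f i).map w).prod = x) :
    HasGF w A x := by
  subst hA
  let e := Equiv.ofInjective f hf
  refine ⟨?_, ?_⟩
  · rw [← e.summable_iff]
    exact hs
  · rw [← e.tsum_eq]
    exact hx

lemma hasGF_of_range_prod {α ι κ : Type*} {w : α → ℂ} {A : Set (List α)} {x y : ℂ}
    {f : ι × κ → List α} {u : ι → ℂ} {v : κ → ℂ} (hf : Function.Injective f)
    (hA : Set.range f = A) (hw : ∀ z, ((f z).map w).prod = u z.1 * v z.2)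
    (hu : Summable fun i => ‖u i‖) (hv : Summable fun j => ‖v j‖) (hx : ∑' i, u i = x)
    (hy : ∑' j, v j = y) : HasGF w A (x * y) := by
  refine hasGF_of_range hf hA ?_ ?_
  · simpa only [hw] using hu.mul_norm hv
  · simp only [hw]
    rw [← tsum_mul_tsum_of_summable_norm hu hv, hx, hy]

lemma HasGF.append {α : Type*} {w : α → ℂ} {A B : Set (List α)} {x y : ℂ}
    (hA : HasGF w A x) (hB : HasGF w B y) (P : α → Prop)
    (hPA : ∀ l ∈ A, ∀ p ∈ l, P p) (hPB : ∀ l ∈ B, ∀ p ∈ l, ¬ P p) :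
    HasGF w (Set.image2 (· ++ ·) A B) (x * y) := by
  classical
  have key : ∀ (a : A) (b : B), (a.1 ++ b.1).filter (fun p => P p) = a.1 ∧
      (a.1 ++ b.1).filter (fun p => ¬ P p) = b.1 := by
    intro a b
    have h1 : a.1.filter (fun p => P p) = a.1 := by
      simpa [List.filter_eq_self] using hPA _ a.2
    have h2 : b.1.filter (fun p => P p) = [] := by
      simpa [List.filter_eq_nil_iff] using hPB _ b.2
    have h3 : a.1.filter (fun p => ¬ P p) = [] := by
      simpa [List.filter_eq_nil_iff] using hPA _ a.2
    have h4 : b.1.filter (fun p => ¬ P p) = b.1 := by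
      simpa [List.filter_eq_self] using hPB _ b.2
    rw [List.filter_append, List.filter_append, h1, h2, h3, h4]
    simp
  refine hasGF_of_range_prod (f := fun z : A × B => z.1.1 ++ z.2.1) ?_ ?_ (by simp)
    hA.1 hB.1 hA.2 hB.2
  · rintro ⟨a, b⟩ ⟨a', b'⟩ h
    simp only at h
    have h1 := key a b
    rw [h, (key a' b').1, (key a' b').2] at h1
    exact Prod.ext (Subtype.ext h1.1.symm) (Subtype.ext h1.2.symm)
  · ext l
    simp [Set.mem_image2]

lemma HasGF.replicate {α : Type*} {w : α → ℂ} (a : α) (ha : ‖w a‖ < 1) :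
    HasGF w {l | ∀ p ∈ l, p = a} (1 / (1 - w a)) := by
  refine hasGF_of_range (f := fun n : ℕ => List.replicate n a) ?_ ?_ ?_ ?_
  · intro m n h
    simpa using congrArg List.length h
  · ext l
    simp only [Set.mem_range, Set.mem_ofPred_eq]
    refine ⟨?_, fun h => ⟨l.length, (List.eq_replicate_of_mem h).symm⟩⟩
    rintro ⟨n, rfl⟩ p hp
    exact List.eq_of_mem_replicate hp
  · simpa using summable_geometric_of_lt_one (norm_nonneg _) ha
  · simpa using tsum_geometric_of_norm_lt_one ha

/-- The alternating word `b? (ab)ⁿ a?`, whose optional letters are switched on by Booleans. -/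
def altWord {α : Type*} (a b : α) (z : (Bool × ℕ) × Bool) : List α :=
  (bif z.1.1 then [b] else []) ++ (List.replicate z.1.2 [a, b]).flatten ++
    (bif z.2 then [a] else [])

lemma altWord_injective {α : Type*} {a b : α} (hab : a ≠ b) :
    Function.Injective (altWord a b) := by
  classical
  rintro ⟨⟨e, n⟩, d⟩ ⟨⟨e', n'⟩, d'⟩ h
  have hca : ∀ n, (List.replicate n [a, b]).flatten.count a = n := by
    intro n
    simp [List.count_flatten, hab.symm]
  have hcb : ∀ n, (List.replicate n [a, b]).flatten.count b = n := by
    intro n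
    simp [List.count_flatten, hab]
  have h1 := congrArg (List.count a) h
  have h2 := congrArg (List.count b) h
  have hd : ∀ e n d, (altWord a b ((e, n), d)).head? = some b ↔ e = true := by
    intro e n d
    cases e <;> cases n <;> cases d <;> simp [altWord, List.replicate_succ, hab]
  simp only [altWord, List.count_append, hca, hcb] at h1 h2
  have he : e = e' := by
    rw [Bool.eq_iff_iff, ← hd e n d, ← hd e' n' d', h]
  subst he
  cases d <;> cases d' <;> simp_all

lemma range_altWord {α : Type*} {a b : α} (hab : a ≠ b) :
    Set.range (altWord a b) = {l | (∀ p ∈ l, p = a ∨ p = b) ∧ l.IsChain (· ≠ ·)} := by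
  ext l
  simp only [Set.mem_range, Set.mem_ofPred_eq]
  constructor
  · rintro ⟨⟨⟨e, n⟩, d⟩, rfl⟩
    have key : (∀ p ∈ altWord a b ((false, n), d), p = a ∨ p = b) ∧
        (b :: altWord a b ((false, n), d)).IsChain (· ≠ ·) := by
      induction n with
      | zero => cases d <;> simp [altWord, hab.symm]
      | succ n ih =>
        have : altWord a b ((false, n + 1), d) = a :: b :: altWord a b ((false, n), d) := by
          simp [altWord, List.replicate_succ]
        rw [this]
        refine ⟨?_, ?_⟩
        · simpa using ih.1
        · simp only [List.isChain_cons_cons]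
          exact ⟨hab.symm, hab, ih.2⟩
    cases e
    · exact ⟨key.1, key.2.tail⟩
    · have : altWord a b ((true, n), d) = b :: altWord a b ((false, n), d) := by
        simp [altWord]
      rw [this]
      exact ⟨by simpa using key.1, key.2⟩
  · rintro ⟨h1, h2⟩
    induction l with
    | nil => exact ⟨((false, 0), false), rfl⟩
    | cons x l ih =>
      obtain ⟨⟨⟨e, n⟩, d⟩, hz⟩ := ih (fun p hp => h1 p (List.mem_cons_of_mem _ hp)) h2.tail
      have hx := h1 x List.mem_cons_self
      subst hz
      cases e
      · rcases hx with rfl | rfl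
        · rcases n with _ | n
          · cases d
            · exact ⟨((false, 0), true), rfl⟩
            · simp [altWord] at h2
          · simp [altWord, List.replicate_succ] at h2
        · exact ⟨((true, n), d), by simp [altWord]⟩
      · rcases hx with rfl | rfl
        · exact ⟨((false, n + 1), d), by simp [altWord, List.replicate_succ]⟩
        · simp [altWord] at h2

lemma HasGF.alternating {α : Type*} {w : α → ℂ} {a b : α} (hab : a ≠ b)
    (h : ‖w a * w b‖ < 1) :
    HasGF w {l | (∀ p ∈ l, p = a ∨ p = b) ∧ l.IsChain (· ≠ ·)}
      ((1 + w b) * (1 / (1 - w a * w b)) * (1 + w a)) := by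
  have hw : ∀ z, ((altWord a b z).map w).prod =
      ((bif z.1.1 then w b else 1) * (w a * w b) ^ z.1.2) * (bif z.2 then w a else 1) := by
    rintro ⟨⟨e, n⟩, d⟩
    cases e <;> cases d <;> simp [altWord, mul_assoc]
  have s1 : Summable fun e : Bool => ‖(bif e then w b else 1 : ℂ)‖ := Summable.of_finite
  have s2 : Summable fun n : ℕ => ‖(w a * w b) ^ n‖ := by
    simpa only [norm_pow] using summable_geometric_of_lt_one (norm_nonneg _) h
  refine hasGF_of_range_prod
    (u := fun z : Bool × ℕ => (bif z.1 then w b else 1) * (w a * w b) ^ z.2)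
    (v := fun e : Bool => bif e then w a else 1)
    (altWord_injective hab) (range_altWord hab) hw (s1.mul_norm s2) Summable.of_finite ?_ ?_
  · rw [← tsum_mul_tsum_of_summable_norm s1 s2, tsum_geometric_of_norm_lt_one h, tsum_bool]
    simp
  · simp [add_comm]

/-- The weight `c_i q^k` of a nonnegative part `k` of colour `c_i`. -/
def partWeight (q : ℂ) (c : ℕ → ℂ) (p : ℤ × ℕ) : ℂ := c p.2 * q ^ p.1.toNat

/-- The level of a coloured part, which is weakly decreasing along multi-grounded partitions. -/
def level (p : ℤ × ℕ) : ℤ := p.1 + p.2 - 1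

lemma step2_iff {x y : ℤ × ℕ} (hx : x.2 ≤ 2) (hy : y.2 ≤ 2) (ox : Odd x.1) (oy : Odd y.1) :
    Step2 x y ↔ level y < level x ∨ level y = level x ∧ (x = y → x.2 = 1) := by
  obtain ⟨a, i⟩ := x
  obtain ⟨b, j⟩ := y
  obtain ⟨m, rfl⟩ := ox
  obtain ⟨n, rfl⟩ := oy
  have key : Step2 (2 * m + 1, i) (2 * n + 1, j) ↔ n + H2 j i ≤ m := by
    simp only [Step2]
    refine ⟨fun ⟨t, ht⟩ => by omega, fun h => ⟨(m - n - H2 j i).toNat, by omega⟩⟩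
  rw [key]
  simp only at hx hy
  simp only [level, H2, Prod.mk.injEq]
  interval_cases i <;> interval_cases j <;> norm_num <;> omega

lemma Step2.odd_left {x y : ℤ × ℕ} (h : Step2 x y) (hy : Odd y.1) : Odd x.1 := by
  obtain ⟨t, ht⟩ := h
  obtain ⟨n, hn⟩ := hy
  exact ⟨t + n + H2 y.2 x.2, by omega⟩

/-- The chains whose parts all lie on level `k`. -/
def levelWords (k : ℤ) : Set (List (ℤ × ℕ)) :=
  {l | (∀ p ∈ l, p.2 ≤ 2 ∧ Odd p.1 ∧ level p = k) ∧ l.IsChain Step2}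

/-- The chains whose parts all lie on a level between `1` and `k`. -/
def boundedWords (k : ℤ) : Set (List (ℤ × ℕ)) :=
  {l | (∀ p ∈ l, p.2 ≤ 2 ∧ Odd p.1 ∧ 1 ≤ level p ∧ level p ≤ k) ∧ l.IsChain Step2}

lemma boundedWords_zero : boundedWords 0 = {[]} := by
  ext l
  simp only [boundedWords, Set.mem_ofPred_eq, Set.mem_singleton_iff]
  refine ⟨fun h => ?_, by rintro rfl; simp⟩
  refine List.eq_nil_iff_forall_not_mem.2 fun p hp => ?_
  have := h.1 p hp
  omega

lemma image2_levelWords_boundedWords {k : ℤ} (hk : 0 ≤ k) :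
    Set.image2 (· ++ ·) (levelWords (k + 1)) (boundedWords k) = boundedWords (k + 1) := by
  ext l
  simp only [Set.mem_image2]
  constructor
  · rintro ⟨a, ha, b, hb, rfl⟩
    refine ⟨fun p hp => ?_, ?_⟩
    · rcases List.mem_append.1 hp with hp | hp
      · have := ha.1 p hp
        exact ⟨this.1, this.2.1, by omega, by omega⟩
      · have := hb.1 p hp
        exact ⟨this.1, this.2.1, by omega, by omega⟩
    · refine List.isChain_append.2 ⟨ha.2, hb.2, fun x hx y hy => ?_⟩
      have hx := ha.1 x (List.mem_of_getLast? hx)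
      have hy := hb.1 y (List.mem_of_head? hy)
      rw [step2_iff hx.1 hy.1 hx.2.1 hy.2.1]
      omega
  · intro h
    induction l with
    | nil => exact ⟨[], by simp [levelWords], [], by simp [boundedWords], rfl⟩
    | cons x l ih =>
      obtain ⟨a, ha, b, hb, rfl⟩ := ih ⟨fun p hp => h.1 p (List.mem_cons_of_mem _ hp), h.2.tail⟩
      have hx := h.1 x List.mem_cons_self
      rcases hx.2.2.2.eq_or_lt with hxk | hxk
      · refine ⟨x :: a, ⟨?_, ?_⟩, b, hb, rfl⟩
        · simpa [hx.1, hx.2.1, hxk] using fun i j hij => ha.1 (i, j) hij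
        · have := h.2
          rw [← List.cons_append, List.isChain_append] at this
          exact this.1
      · cases a with
        | nil =>
          refine ⟨[], by simp [levelWords], x :: b, ⟨?_, h.2⟩, rfl⟩
          intro p hp
          rcases List.mem_cons.1 hp with rfl | hp
          · exact ⟨hx.1, hx.2.1, hx.2.2.1, by omega⟩
          · exact hb.1 p hp
        | cons y a =>
          have hy := ha.1 y List.mem_cons_self
          have hxy := (List.isChain_cons_cons.1 h.2).1
          rw [step2_iff hx.1 hy.1 hx.2.1 hy.2.1] at hxy
          omega

lemma levelWords_odd (m : ℕ) :
    levelWords (2 * m + 1) = {l | ∀ p ∈ l, p = ((2 * m + 1 : ℤ), 1)} := by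
  have key : ∀ p : ℤ × ℕ, (p.2 ≤ 2 ∧ Odd p.1 ∧ level p = 2 * m + 1) ↔
      p = ((2 * m + 1 : ℤ), 1) := by
    rintro ⟨a, i⟩
    simp only [level, Prod.mk.injEq, Int.odd_iff]
    omega
  ext l
  simp only [levelWords, key, Set.mem_ofPred_eq, and_iff_left_iff_imp]
  intro h
  refine List.Pairwise.isChain (List.pairwise_of_forall_mem_list fun x hx y hy => ?_)
  rw [h x hx, h y hy]
  exact ⟨0, by simp [H2]⟩

lemma levelWords_even (m : ℕ) :
    levelWords (2 * m + 2) = {l | (∀ p ∈ l, p = ((2 * m + 1 : ℤ), 2) ∨ p = ((2 * m + 3 : ℤ), 0)) ∧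
      l.IsChain (· ≠ ·)} := by
  have key : ∀ p : ℤ × ℕ, (p.2 ≤ 2 ∧ Odd p.1 ∧ level p = 2 * m + 2) ↔
      (p = ((2 * m + 1 : ℤ), 2) ∨ p = ((2 * m + 3 : ℤ), 0)) := by
    rintro ⟨a, i⟩
    simp only [level, Prod.mk.injEq, Int.odd_iff]
    omega
  ext l
  simp only [levelWords, key, Set.mem_ofPred_eq]
  refine and_congr_right fun h => List.IsChain.iff_of_mem_imp fun x y hx hy => ?_
  have hx' := (key x).2 (h x hx)
  have hy' := (key y).2 (h y hy)
  rw [step2_iff hx'.1 hy'.1 hx'.2.1 hy'.2.1]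
  have : x.2 ≠ 1 := by rcases h x hx with rfl | rfl <;> simp
  simp [hx'.2.2, hy'.2.2, this]

lemma summable_norm_mul_pow (a : ℂ) {r : ℂ} (hr : ‖r‖ < 1) :
    Summable fun k : ℕ => ‖-(a * r ^ k)‖ := by
  simpa using (summable_geometric_of_lt_one (norm_nonneg r) hr).mul_left ‖a‖

lemma multipliable_qPoch (a : ℂ) {r : ℂ} (hr : ‖r‖ < 1) :
    Multipliable fun k : ℕ => 1 - a * r ^ k := by
  simpa [sub_eq_add_neg] using multipliable_one_add_of_summable (summable_norm_mul_pow a hr)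

lemma tendsto_qPoch (a : ℂ) {r : ℂ} (hr : ‖r‖ < 1) :
    Tendsto (fun n => ∏ k ∈ Finset.range n, (1 - a * r ^ k)) atTop (𝓝 (qPoch a r)) :=
  (multipliable_qPoch a hr).tendsto_prod_tprod_nat

lemma norm_mul_pow_lt_one {a r : ℂ} (ha : ‖a‖ ≤ 1) (hr : ‖r‖ < 1) {k : ℕ} (hk : k ≠ 0) :
    ‖a * r ^ k‖ < 1 := by
  rw [norm_mul, norm_pow]
  exact (mul_le_of_le_one_left (by positivity) ha).trans_lt (pow_lt_one₀ (norm_nonneg _) hr hk)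

lemma one_sub_ne_zero_of_norm_lt_one {a : ℂ} (ha : ‖a‖ < 1) : 1 - a ≠ 0 := by
  intro h
  rw [← sub_eq_zero.1 h] at ha
  simp at ha

lemma qPoch_ne_zero {a r : ℂ} (ha : ‖a‖ < 1) (hr : ‖r‖ < 1) : qPoch a r ≠ 0 := by
  have := tprod_one_add_ne_zero_of_summable (f := fun k : ℕ => -(a * r ^ k)) (fun k => ?_)
    (summable_norm_mul_pow a hr)
  · simpa [qPoch, sub_eq_add_neg] using this
  · rw [← sub_eq_add_neg]
    apply one_sub_ne_zero_of_norm_lt_one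
    rw [norm_mul, norm_pow]
    exact (mul_le_of_le_one_right (norm_nonneg _) (pow_le_one₀ (norm_nonneg _) hr.le)).trans_lt ha

lemma qPoch_eq_mul (a : ℂ) {r : ℂ} (hr : ‖r‖ < 1) : qPoch a r = (1 - a) * qPoch (a * r) r := by
  have h : ∀ k : ℕ, 1 - a * r ^ (k + 1) = 1 - a * r * r ^ k := fun k => by ring
  rw [qPoch, qPoch, tprod_eq_zero_mul']
  · simp only [h, pow_zero, mul_one]
  · simpa only [h] using multipliable_qPoch (a * r) hr

lemma norm_mul_le_one {a b : ℂ} (ha : ‖a‖ ≤ 1) (hb : ‖b‖ ≤ 1) : ‖a * b‖ ≤ 1 := by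
  rw [norm_mul]
  exact mul_le_one₀ ha (norm_nonneg _) hb

/-- The generating function of the chains living on the levels `2m + 1` and `2m + 2`. -/
noncomputable def levelFactor (q : ℂ) (c : ℕ → ℂ) (m : ℕ) : ℂ :=
  (1 + c 0 * q ^ (2 * m + 3)) * (1 / (1 - c 0 * c 2 * q ^ (4 * m + 4))) *
    (1 + c 2 * q ^ (2 * m + 1)) * (1 / (1 - c 1 * q ^ (2 * m + 1)))

lemma hasGF_boundedWords {q : ℂ} {c : ℕ → ℂ} (hq : ‖q‖ < 1) (hc : ∀ i, ‖c i‖ ≤ 1) (n : ℕ) :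
    HasGF (partWeight q c) (boundedWords (2 * n)) (∏ m ∈ Finset.range n, levelFactor q c m) := by
  induction n with
  | zero =>
    simpa [boundedWords_zero] using
      hasGF_of_range (w := partWeight q c) (A := {[]}) (f := fun _ : Unit => [])
        (fun _ _ _ => rfl) (by simp) Summable.of_finite rfl
  | succ n ih =>
    have w0 : partWeight q c ((2 * n + 3 : ℤ), 0) = c 0 * q ^ (2 * n + 3) := by
      simp only [partWeight]
      congr 2
    have w1 : partWeight q c ((2 * n + 1 : ℤ), 1) = c 1 * q ^ (2 * n + 1) := by
      simp only [partWeight]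
      congr 2
    have w2 : partWeight q c ((2 * n + 1 : ℤ), 2) = c 2 * q ^ (2 * n + 1) := by
      simp only [partWeight]
      congr 2
    have e02 : c 2 * q ^ (2 * n + 1) * (c 0 * q ^ (2 * n + 3)) = c 0 * c 2 * q ^ (4 * n + 4) := by
      ring
    have odd := HasGF.replicate (w := partWeight q c) ((2 * n + 1 : ℤ), 1)
      (by rw [w1]; exact norm_mul_pow_lt_one (hc 1) hq (by omega))
    have even := HasGF.alternating (w := partWeight q c) (a := ((2 * n + 1 : ℤ), 2))
      (b := ((2 * n + 3 : ℤ), 0)) (by simp)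
      (by rw [w2, w0, e02]; exact norm_mul_pow_lt_one (norm_mul_le_one (hc 0) (hc 2)) hq (by omega))
    rw [← levelWords_odd, w1] at odd
    rw [← levelWords_even, w0, w2, e02] at even
    have h1 := odd.append ih (fun p => 2 * n < level p)
      (fun l hl p hp => by have := (hl.1 p hp).2.2; omega)
      (fun l hl p hp => by have := (hl.1 p hp).2.2; omega)
    rw [image2_levelWords_boundedWords (by positivity)] at h1
    have h2 := even.append h1 (fun p => 2 * n + 1 < level p)
      (fun l hl p hp => by have := (hl.1 p hp).2.2; omega)
      (fun l hl p hp => by have := (hl.1 p hp).2.2; omega)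
    rw [show (2 * n + 2 : ℤ) = 2 * n + 1 + 1 by ring,
      image2_levelWords_boundedWords (by positivity)] at h2
    convert h2 using 1
    · push_cast
      ring_nf
    · rw [Finset.prod_range_succ, levelFactor]
      ring

lemma tendsto_prod_levelFactor {q : ℂ} {c : ℕ → ℂ} (hq : ‖q‖ < 1) (hc : ∀ i, ‖c i‖ ≤ 1) :
    Tendsto (fun n => ∏ m ∈ Finset.range n, levelFactor q c m) atTop
      (𝓝 (qPoch (-c 0 * q ^ 3) (q ^ 2) * (qPoch (c 0 * c 2 * q ^ 4) (q ^ 4))⁻¹ *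
        qPoch (-c 2 * q) (q ^ 2) * (qPoch (c 1 * q) (q ^ 2))⁻¹)) := by
  have hq2 : ‖q ^ 2‖ < 1 := by simpa using norm_mul_pow_lt_one (a := 1) (by simp) hq two_ne_zero
  have hq4 : ‖q ^ 4‖ < 1 := by simpa using norm_mul_pow_lt_one (a := 1) (by simp) hq four_ne_zero
  have n1 : qPoch (c 1 * q) (q ^ 2) ≠ 0 :=
    qPoch_ne_zero (by simpa using norm_mul_pow_lt_one (hc 1) hq one_ne_zero) hq2
  have n2 : qPoch (c 0 * c 2 * q ^ 4) (q ^ 4) ≠ 0 :=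
    qPoch_ne_zero (norm_mul_pow_lt_one (norm_mul_le_one (hc 0) (hc 2)) hq four_ne_zero) hq4
  refine ((((tendsto_qPoch (-c 0 * q ^ 3) hq2).mul
    ((tendsto_qPoch (c 0 * c 2 * q ^ 4) hq4).inv₀ n2)).mul
    (tendsto_qPoch (-c 2 * q) hq2)).mul ((tendsto_qPoch (c 1 * q) hq2).inv₀ n1)).congr fun n => ?_
  rw [← Finset.prod_inv_distrib, ← Finset.prod_inv_distrib, ← Finset.prod_mul_distrib,
    ← Finset.prod_mul_distrib, ← Finset.prod_mul_distrib]
  refine Finset.prod_congr rfl fun m _ => ?_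
  rw [levelFactor, one_div, one_div]
  congr 1
  · congr 1
    · congr 1
      · ring
      · ring
    · ring
  · ring

/-- The chains whose parts all lie on a positive level. -/
def positiveWords : Set (List (ℤ × ℕ)) :=
  {l | (∀ p ∈ l, p.2 ≤ 2 ∧ Odd p.1 ∧ 1 ≤ level p) ∧ l.IsChain Step2}

lemma boundedWords_subset (k : ℤ) : boundedWords k ⊆ positiveWords :=
  fun _ hl => ⟨fun p hp => ⟨(hl.1 p hp).1, (hl.1 p hp).2.1, (hl.1 p hp).2.2.1⟩, hl.2⟩

lemma eventually_mem_boundedWords {l : List (ℤ × ℕ)} (hl : l ∈ positiveWords) :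
    ∀ᶠ n : ℕ in atTop, l ∈ boundedWords (2 * n) := by
  have : ∃ n : ℕ, ∀ p ∈ l, level p ≤ 2 * n := by
    refine ⟨(l.map fun p => (level p).toNat).sum, fun p hp => ?_⟩
    have := List.single_le_sum (l := l.map fun p => (level p).toNat) (by simp) (level p).toNat
      (List.mem_map_of_mem hp)
    omega
  obtain ⟨n, hn⟩ := this
  filter_upwards [eventually_ge_atTop n] with m hm
  refine ⟨fun p hp => ⟨(hl.1 p hp).1, (hl.1 p hp).2.1, (hl.1 p hp).2.2, ?_⟩, hl.2⟩
  have := hn p hp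
  omega

lemma norm_prod_partWeight (q : ℂ) (c : ℕ → ℂ) (l : List (ℤ × ℕ)) :
    (‖(l.map (partWeight q c)).prod‖ : ℂ) =
      (l.map (partWeight ‖q‖ fun i => (‖c i‖ : ℂ))).prod := by
  induction l with
  | nil => simp
  | cons p l ih => simp [← ih, partWeight]

lemma summable_positiveWords {q : ℂ} {c : ℕ → ℂ} (hq : ‖q‖ < 1) (hc : ∀ i, ‖c i‖ ≤ 1) :
    Summable fun l : positiveWords => ‖(l.1.map (partWeight q c)).prod‖ := by
  have hq' : ‖(‖q‖ : ℂ)‖ < 1 := by simpa using hq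
  have hc' : ∀ i, ‖(‖c i‖ : ℂ)‖ ≤ 1 := by simpa using hc
  obtain ⟨C, hC⟩ := (tendsto_prod_levelFactor hq' hc').norm.bddAbove_range
  refine summable_of_sum_le (fun _ => norm_nonneg _) (c := C) fun F => ?_
  have hF : ∀ᶠ n : ℕ in atTop, ∀ l ∈ F, l.1 ∈ boundedWords (2 * n) :=
    (Finset.eventually_all F).2 fun l _ => eventually_mem_boundedWords l.2
  obtain ⟨n, hn⟩ := hF.exists
  have hs := (hasGF_boundedWords hq hc n).1
  have hx := (hasGF_boundedWords hq' hc' n).2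
  have hC' := hC ⟨n, rfl⟩
  simp only [← norm_prod_partWeight, ← Complex.ofReal_tsum] at hx
  simp only [← hx, Complex.norm_real] at hC'
  classical
  calc ∑ l ∈ F, ‖(l.1.map (partWeight q c)).prod‖
      = ∑ l ∈ F.attach.map ⟨fun l => (⟨l.1.1, hn l.1 l.2⟩ : boundedWords (2 * n)), fun a b h =>
          Subtype.ext (Subtype.ext (congrArg (fun l => l.1) h))⟩,
          ‖(l.1.map (partWeight q c)).prod‖ := by
        rw [Finset.sum_map]
        exact (Finset.sum_attach F fun l => ‖(l.1.map (partWeight q c)).prod‖).symm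
    _ ≤ ∑' l : boundedWords (2 * n), ‖(l.1.map (partWeight q c)).prod‖ :=
        hs.sum_le_tsum _ fun _ _ => norm_nonneg _
    _ ≤ C := (le_abs_self _).trans hC'

lemma hasGF_positiveWords {q : ℂ} {c : ℕ → ℂ} (hq : ‖q‖ < 1) (hc : ∀ i, ‖c i‖ ≤ 1) :
    HasGF (partWeight q c) positiveWords
      (qPoch (-c 0 * q ^ 3) (q ^ 2) * (qPoch (c 0 * c 2 * q ^ 4) (q ^ 4))⁻¹ *
        qPoch (-c 2 * q) (q ^ 2) * (qPoch (c 1 * q) (q ^ 2))⁻¹) := by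
  refine ⟨summable_positiveWords hq hc, ?_⟩
  set W : List (ℤ × ℕ) → ℂ := fun l => (l.map (partWeight q c)).prod with hW
  have hs : Summable (positiveWords.indicator fun l => ‖W l‖) :=
    summable_subtype_iff_indicator.1 (summable_positiveWords hq hc)
  have hlim : Tendsto (fun n : ℕ => ∑' l, (boundedWords (2 * n)).indicator W l) atTop
      (𝓝 (∑' l, positiveWords.indicator W l)) := by
    refine tendsto_tsum_of_dominated_convergence hs (fun l => ?_) (.of_forall fun n l => ?_)
    · refine tendsto_const_nhds.congr' ?_
      by_cases hl : l ∈ positiveWords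
      · filter_upwards [eventually_mem_boundedWords hl] with n hn
        simp [hl, hn]
      · filter_upwards with n
        have : l ∉ boundedWords (2 * n) := fun h => hl (boundedWords_subset _ h)
        simp [hl, this]
    · rw [norm_indicator_eq_indicator_norm]
      exact Set.indicator_le_indicator_of_subset (boundedWords_subset _) (fun _ => norm_nonneg _) l
  rw [← tsum_subtype positiveWords W] at hlim
  refine tendsto_nhds_unique hlim ((tendsto_prod_levelFactor hq hc).congr fun n => ?_)
  rw [← (hasGF_boundedWords hq hc n).2, ← tsum_subtype]

/-- The multi-grounded partitions with their last two parts removed. -/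
def groundedWords : Set (List (ℤ × ℕ)) :=
  Set.image2 (· ++ ·) positiveWords {[], [((1 : ℤ), 0)]}

lemma hasGF_groundedWords {q : ℂ} {c : ℕ → ℂ} (hq : ‖q‖ < 1) (hc : ∀ i, ‖c i‖ ≤ 1) :
    HasGF (partWeight q c) groundedWords
      (qPoch (-c 0 * q) (q ^ 2) * (qPoch (c 0 * c 2 * q ^ 4) (q ^ 4))⁻¹ *
        qPoch (-c 2 * q) (q ^ 2) * (qPoch (c 1 * q) (q ^ 2))⁻¹) := by
  have hq2 : ‖q ^ 2‖ < 1 := by simpa using norm_mul_pow_lt_one (a := 1) (by simp) hq two_ne_zero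
  have h0 : HasGF (partWeight q c) {[], [((1 : ℤ), 0)]} (1 + c 0 * q) := by
    refine hasGF_of_range (f := fun e : Bool => bif e then [((1 : ℤ), 0)] else []) ?_ ?_
      Summable.of_finite ?_
    · intro e e'
      cases e <;> cases e' <;> simp
    · ext l
      simp
    · simp [partWeight, add_comm]
  have := (hasGF_positiveWords hq hc).append h0 (fun p => 1 ≤ level p)
    (fun l hl p hp => (hl.1 p hp).2.2) (by simp [level])
  refine (congrArg _ ?_).mp this
  rw [qPoch_eq_mul (-c 0 * q) hq2]
  ring_nf

lemma groundedWords_props {l : List (ℤ × ℕ)} (hl : l ∈ groundedWords) :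
    ∀ p ∈ l, p.2 ≤ 2 ∧ 0 ≤ p.1 := by
  obtain ⟨a, ha, b, hb, rfl⟩ := hl
  intro p hp
  rcases List.mem_append.1 hp with hp | hp
  · obtain ⟨h1, ⟨n, hn⟩, h3⟩ := ha.1 p hp
    simp only [level] at h3
    exact ⟨h1, by omega⟩
  · rcases hb with rfl | rfl
    · simp at hp
    · simp only [List.mem_singleton] at hp
      subst hp
      simp

lemma mem_groundedWords_of_isChain {l : List (ℤ × ℕ)} (hc : ∀ p ∈ l, p.2 ≤ 2)
    (hl : (l ++ [((-1 : ℤ), 2), ((1 : ℤ), 0)]).IsChain Step2)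
    (hg : ¬ ∃ l', l = l' ++ [((-1 : ℤ), 2), ((1 : ℤ), 0)]) :
    l ∈ groundedWords ∧ ∀ p ∈ l, Odd p.1 := by
  induction l with
  | nil => exact ⟨⟨[], by simp [positiveWords], [], by simp, rfl⟩, by simp⟩
  | cons x l ih =>
    obtain ⟨⟨a, ha, b, hb, rfl⟩, ho⟩ := ih (fun p hp => hc p (List.mem_cons_of_mem _ hp)) hl.tail
      (fun ⟨l', h⟩ => hg ⟨x :: l', by rw [h]; rfl⟩)
    have hx := hc x List.mem_cons_self
    cases a with
    | nil =>
      rcases hb with rfl | rfl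
      · have hs : Step2 x (-1, 2) := (List.isChain_cons_cons.1 hl).1
        have hxo := hs.odd_left ⟨-1, rfl⟩
        rw [step2_iff hx (by simp) hxo ⟨-1, rfl⟩] at hs
        refine ⟨?_, by simpa using hxo⟩
        by_cases h1 : 1 ≤ level x
        · exact ⟨[x], ⟨fun p hp => List.mem_singleton.1 hp ▸ ⟨hx, hxo, h1⟩, by simp⟩, [],
            by simp, rfl⟩
        · refine ⟨[], by simp [positiveWords], [(1, 0)], by simp, ?_⟩
          obtain ⟨p, i⟩ := x
          obtain ⟨n, rfl⟩ := hxo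
          simp only [level, Prod.mk.injEq] at *
          simp only [List.nil_append, List.append_nil, List.cons.injEq, Prod.mk.injEq, and_true]
          omega
      · have hs : Step2 x (1, 0) := (List.isChain_cons_cons.1 hl).1
        have hxo := hs.odd_left ⟨0, rfl⟩
        rw [step2_iff hx (by simp) hxo ⟨0, rfl⟩] at hs
        refine ⟨⟨[x], ⟨?_, by simp⟩, [(1, 0)], by simp, rfl⟩, by simpa using hxo⟩
        have hne : x ≠ (-1, 2) := by
          rintro rfl
          exact hg ⟨[], rfl⟩
        obtain ⟨p, i⟩ := x
        obtain ⟨n, rfl⟩ := hxo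
        simp only [level, ne_eq, Prod.mk.injEq] at *
        simp only [List.mem_singleton, forall_eq]
        refine ⟨hx, ⟨n, rfl⟩, ?_⟩
        omega
    | cons y a =>
      have hy := ha.1 y List.mem_cons_self
      have hs : Step2 x y := (List.isChain_cons_cons.1 hl).1
      have hxo := hs.odd_left hy.2.1
      have hs' := hs
      rw [step2_iff hx hy.1 hxo hy.2.1] at hs'
      refine ⟨⟨x :: y :: a, ⟨?_, List.isChain_cons_cons.2 ⟨hs, ha.2⟩⟩, b, hb, rfl⟩, ?_⟩
      · intro p hp
        rcases List.mem_cons.1 hp with rfl | hp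
        · exact ⟨hx, hxo, by omega⟩
        · exact ha.1 p hp
      · intro p hp
        rcases List.mem_cons.1 hp with rfl | hp
        · exact hxo
        · exact ho p hp

lemma mg20_append_iff (l : List (ℤ × ℕ)) :
    MG20 (l ++ [((-1 : ℤ), 2), ((1 : ℤ), 0)]) ↔ l ∈ groundedWords := by
  constructor
  · rintro ⟨h1, h2, l', h3, h4⟩
    obtain rfl := List.append_cancel_right h3
    exact (mem_groundedWords_of_isChain (fun p hp => h1 p (List.mem_append_left _ hp)) h2 h4).1
  · intro hl
    refine ⟨?_, ?_, l, rfl, ?_⟩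
    · intro p hp
      rcases List.mem_append.1 hp with hp | hp
      · exact (groundedWords_props hl p hp).1
      · simp only [List.mem_cons, List.not_mem_nil, or_false] at hp
        rcases hp with rfl | rfl <;> simp
    · have hp : ∀ a ∈ positiveWords, ∀ y : ℤ × ℕ, y.2 ≤ 2 → Odd y.1 → level y = 0 →
          ∀ x ∈ a.getLast?, Step2 x y := by
        intro a ha y hy oy ly x hx
        obtain ⟨h1, h2, h3⟩ := ha.1 x (List.mem_of_getLast? hx)
        rw [step2_iff h1 hy h2 oy]
        omega
      have ht : ([((-1 : ℤ), 2), ((1 : ℤ), 0)] : List (ℤ × ℕ)).IsChain Step2 := by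
        simp only [List.isChain_cons_cons, List.isChain_singleton, and_true]
        exact ⟨0, by simp [H2]⟩
      have ht' : ([((1 : ℤ), 0), ((-1 : ℤ), 2), ((1 : ℤ), 0)] : List (ℤ × ℕ)).IsChain Step2 :=
        List.isChain_cons_cons.2 ⟨⟨0, by simp [H2]⟩, ht⟩
      obtain ⟨a, ha, b, hb, rfl⟩ := hl
      rcases hb with rfl | rfl
      · simp only [List.append_nil]
        refine List.isChain_append.2 ⟨ha.2, ht, fun x hx y hy => ?_⟩
        obtain rfl : (-1, 2) = y := by simpa using hy
        exact hp a ha _ (by simp) ⟨-1, rfl⟩ (by simp [level]) x hx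
      · simp only [List.append_assoc]
        refine List.isChain_append.2 ⟨ha.2, ht', fun x hx y hy => ?_⟩
        obtain rfl : (1, 0) = y := by simpa using hy
        exact hp a ha _ (by simp) ⟨0, rfl⟩ (by simp [level]) x hx
    · rintro ⟨l', rfl⟩
      have := (groundedWords_props hl (-1, 2) (by simp)).2
      simp at this

/-- The colour weights `c_0, c_1, c_2` as a function of the colour index. -/
def colourWeight (c0 c1 c2 : ℂ) (i : ℕ) : ℂ := if i = 0 then c0 else if i = 1 then c1 else c2

lemma prod_partWeight_eq (q c0 c1 c2 : ℂ) {l : List (ℤ × ℕ)} (hl : ∀ p ∈ l, p.2 ≤ 2 ∧ 0 ≤ p.1) :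
    c0 ^ (l.countP fun p => p.2 == 0) * c1 ^ (l.countP fun p => p.2 == 1) *
      c2 ^ (l.countP fun p => p.2 == 2) * q ^ ((l.map Prod.fst).sum) =
      (l.map (partWeight q (colourWeight c0 c1 c2))).prod := by
  have hsum : (l.map Prod.fst).sum = ((l.map fun p => p.1.toNat).sum : ℕ) := by
    induction l with
    | nil => simp
    | cons p l ih =>
      simp only [List.map_cons, List.sum_cons, ih fun p hp => hl p (List.mem_cons_of_mem _ hp),
        Nat.cast_add, Int.toNat_of_nonneg (hl p List.mem_cons_self).2]
  rw [hsum, zpow_natCast]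
  clear hsum
  induction l with
  | nil => simp
  | cons p l ih =>
    rw [List.map_cons, List.map_cons, List.sum_cons, List.prod_cons,
      ← ih fun p hp => hl p (List.mem_cons_of_mem _ hp)]
    obtain ⟨n, i⟩ := p
    have hi := (hl _ List.mem_cons_self).1
    simp only at hi
    interval_cases i <;> simp [partWeight, colourWeight, pow_add, pow_succ] <;>
      ring

lemma prod_partWeight_neg (q : ℂ) (c : ℕ → ℂ) (l : List (ℤ × ℕ)) :
    (l.map (partWeight q fun i => -c i)).prod =
      (-1) ^ l.length * (l.map (partWeight q c)).prod := by
  induction l with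
  | nil => simp
  | cons p l ih =>
    simp only [List.map_cons, List.prod_cons, ih, List.length_cons, partWeight]
    ring

lemma tsum_even_groundedWords {q : ℂ} {c : ℕ → ℂ} (hq : ‖q‖ < 1) (hc : ∀ i, ‖c i‖ ≤ 1) :
    ∑' l : {l | l ∈ groundedWords ∧ Even l.length}, (l.1.map (partWeight q c)).prod =
      1 / 2 * (∑' l : groundedWords, (l.1.map (partWeight q c)).prod +
        ∑' l : groundedWords, (l.1.map (partWeight q fun i => -c i)).prod) := by
  have h1 := (hasGF_groundedWords hq hc).1.of_norm
  have h2 := (hasGF_groundedWords (c := fun i => -c i) hq (by simpa using hc)).1.of_norm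
  rw [← h1.tsum_add h2, ← tsum_mul_left,
    tsum_subtype {l | l ∈ groundedWords ∧ Even l.length} fun l => (l.map (partWeight q c)).prod,
    tsum_subtype groundedWords fun l => 1 / 2 * ((l.map (partWeight q c)).prod +
      (l.map (partWeight q fun i => -c i)).prod)]
  refine tsum_congr fun l => ?_
  by_cases hl : l ∈ groundedWords
  · rcases Nat.even_or_odd l.length with he | ho
    · simp [hl, he, prod_partWeight_neg]
      ring
    · simp [hl, ho, prod_partWeight_neg]
  · simp [hl]

lemma genFun_even_eq (q c0 c1 c2 : ℂ) :
    genFun (fun L => MG20 L ∧ Even L.length) q c0 c1 c2 =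
      c0 * c2 * ∑' l : {l | l ∈ groundedWords ∧ Even l.length},
        (l.1.map (partWeight q (colourWeight c0 c1 c2))).prod := by
  let f : {l | l ∈ groundedWords ∧ Even l.length} → {L // MG20 L ∧ Even L.length} :=
    fun l => ⟨l.1 ++ [((-1 : ℤ), 2), ((1 : ℤ), 0)], (mg20_append_iff _).2 l.2.1, by
      simpa [Nat.even_add] using l.2.2⟩
  have hf : Function.Bijective f := by
    constructor
    · intro a b h
      exact Subtype.ext (List.append_cancel_right (congrArg Subtype.val h))
    · rintro ⟨L, hL, he⟩
      obtain ⟨l, rfl, -⟩ := hL.2.2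
      exact ⟨⟨l, (mg20_append_iff _).1 hL, by simpa [Nat.even_add] using he⟩, rfl⟩
  rw [genFun, ← (Equiv.ofBijective f hf).tsum_eq, ← tsum_mul_left]
  refine tsum_congr fun l => ?_
  rw [← prod_partWeight_eq q c0 c1 c2 (groundedWords_props l.2.1)]
  simp [f, pow_succ]
  ring

/-- The generating function of multi-grounded partitions in `²𝒫^≫_{c_2 c_0}` with an even
total number of parts:
`∑_π C(π) q^{|π|} = (c_0 c_2 / (c_0 c_2 q⁴; q⁴)_∞) · ½ ·
  [ (−c_0 q; q²)_∞ (−c_2 q; q²)_∞ / (c_1 q; q²)_∞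
    + (c_0 q; q²)_∞ (c_2 q; q²)_∞ / (−c_1 q; q²)_∞ ]`. -/
theorem mg20EvenGenFun (q c0 c1 c2 : ℂ) (hq : ‖q‖ < 1)
    (h0 : ‖c0‖ ≤ 1) (h1 : ‖c1‖ ≤ 1) (h2 : ‖c2‖ ≤ 1) :
    genFun (fun L => MG20 L ∧ Even L.length) q c0 c1 c2 =
      c0 * c2 / qPoch (c0 * c2 * q ^ 4) (q ^ 4) * (1 / 2) *
        (qPoch (-c0 * q) (q ^ 2) * qPoch (-c2 * q) (q ^ 2) / qPoch (c1 * q) (q ^ 2) +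
          qPoch (c0 * q) (q ^ 2) * qPoch (c2 * q) (q ^ 2) / qPoch (-c1 * q) (q ^ 2)) := by
  have hc : ∀ i, ‖colourWeight c0 c1 c2 i‖ ≤ 1 := by
    intro i
    simp only [colourWeight]
    split_ifs <;> assumption
  rw [genFun_even_eq, tsum_even_groundedWords hq hc, (hasGF_groundedWords hq hc).2,
    (hasGF_groundedWords (c := fun i => -colourWeight c0 c1 c2 i) hq (by simpa using hc)).2]
  simp only [colourWeight, if_true, one_ne_zero, two_ne_zero, if_false, OfNat.ofNat_ne_one,
    neg_neg, neg_mul_neg, div_eq_mul_inv]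
  ring
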